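/- Let V be a meromorphic open-string vertex algebra and W a V-bimodule. Then for all u_1, u_2 ∈ V, w ∈ W and w' ∈ W', the series ⟨w', Y_W^L(u_1,z_1)Y_W^{s(R)}(u_2,z_2)w⟩ and ⟨w', Y_W^{s(R)}(u_2,z_2)Y_W^L(u_1,z_1)w⟩ converge absolutely in the regions |z_1|>|z_2|>0 and |z_2|>|z_1|>0 respectively, to a common rational function in z_1 and z_2. -/

import Mathlib

set_option autoImplicit false
set_option maxHeartbeats 1000000

open scoped BigOperators

noncomputable section

namespace VA

/-- Absolute convergence of a series of complex numbers indexed by `ι` to the sum `s`. -/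
def AbsConvTo {ι : Type*} (f : ι → ℂ) (s : ℂ) : Prop :=
  Summable (fun i => ‖f i‖) ∧ HasSum f s

/-- The configuration-space condition: the entries of `z` are pairwise distinct. -/
def Conf {ι : Type*} (z : ι → ℂ) : Prop := ∀ i j : ι, i ≠ j → z i ≠ z j

/-- `‖z 0‖ > ‖z 1‖ > ⋯ > ‖z (n-1)‖`. -/
def Ordered {n : ℕ} (z : Fin n → ℂ) : Prop := ∀ i j : Fin n, i < j → ‖z j‖ < ‖z i‖

/-- `‖z 0‖ > ‖z 1‖ > ⋯ > ‖z (n-1)‖ > 0`. -/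
def OrderedPos {n : ℕ} (z : Fin n → ℂ) : Prop := Ordered z ∧ ∀ i, 0 < ‖z i‖

/-- A rational function in the variables `z i`, `i : ι`, whose only possible poles are
at `z i = 0` and on the diagonals `z i = z j` (`i ≠ j`); it is recorded as a numerator
polynomial together with the orders of the poles. -/
structure RatFn (ι : Type*) [Fintype ι] [DecidableEq ι] where
  num : MvPolynomial ι ℂ
  a : ι → ℕ
  b : ι → ι → ℕ

def RatFn.eval {ι : Type*} [Fintype ι] [DecidableEq ι] (R : RatFn ι) (z : ι → ℂ) : ℂ :=
  MvPolynomial.eval z R.num /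
    ((∏ i, z i ^ R.a i) * ∏ q ∈ Finset.univ.offDiag, (z q.1 - z q.2) ^ R.b q.1 q.2)

/-- A rational function in the variables `z i`, `i : ι`, whose only possible poles are
on the diagonals `z i = z j` (`i ≠ j`). -/
structure DiagRatFn (ι : Type*) [Fintype ι] [DecidableEq ι] where
  num : MvPolynomial ι ℂ
  b : ι → ι → ℕ

def DiagRatFn.eval {ι : Type*} [Fintype ι] [DecidableEq ι] (R : DiagRatFn ι) (z : ι → ℂ) : ℂ :=
  MvPolynomial.eval z R.num / ∏ q ∈ Finset.univ.offDiag, (z q.1 - z q.2) ^ R.b q.1 q.2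

/-- A linear functional belongs to the graded dual iff its restriction to all but
finitely many homogeneous components vanishes. -/
def InGradedDual {ι : Type*} {M : Type*} [AddCommGroup M] [Module ℂ M]
    (proj : ι → M →ₗ[ℂ] M) (φ : M →ₗ[ℂ] ℂ) : Prop :=
  (Function.support fun i => φ ∘ₗ proj i).Finite

/-- Iterated application: `compApply n f w = f 0 (f 1 (⋯ (f (n-1) w)))`. -/
def compApply {M : Type*} : (n : ℕ) → (Fin n → (M → M)) → M → M
  | 0, _, w => w
  | n+1, f, w => f 0 (compApply n (fun i => f i.succ) w)

section Graded

variable (W : Type*) [AddCommGroup W] [Module ℂ W]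

/-- A `ℂ`-grading of `W`, recorded via the projections onto the homogeneous
subspaces, whose weights have lower-bounded real parts. -/
structure CGrading where
  proj : ℂ → W →ₗ[ℂ] W
  proj_comp : ∀ m n : ℂ, proj m ∘ₗ proj n = if m = n then proj n else 0
  proj_finite : ∀ w : W, (Function.support fun n => proj n w).Finite
  proj_sum : ∀ w : W, (∑ᶠ n : ℂ, proj n w) = w
  lower_bound : ∃ B : ℝ, ∀ n : ℂ, n.re < B → proj n = 0

/-- A `ℤ`-grading of `V` with lower-bounded weights. -/
structure ZGrading where
  proj : ℤ → W →ₗ[ℂ] W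
  proj_comp : ∀ m n : ℤ, proj m ∘ₗ proj n = if m = n then proj n else 0
  proj_finite : ∀ w : W, (Function.support fun n => proj n w).Finite
  proj_sum : ∀ w : W, (∑ᶠ n : ℤ, proj n w) = w
  lower_bound : ∃ B : ℤ, ∀ n : ℤ, n < B → proj n = 0

variable {W}

/-- The grading operator `d` of a `ℂ`-graded space. -/
def CGrading.d (G : CGrading W) (w : W) : W := ∑ᶠ n : ℂ, n • G.proj n w

/-- The grading operator `d` of a `ℤ`-graded space. -/
def ZGrading.d (G : ZGrading W) (v : W) : W := ∑ᶠ n : ℤ, (n : ℂ) • G.proj n v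

/-- The operator `z^d` on a `ℤ`-graded space. -/
def ZGrading.zd (G : ZGrading W) (z : ℂ) (v : W) : W := ∑ᶠ n : ℤ, (z ^ n) • G.proj n v

/-- The algebraic completion `∏ₙ W_[n]`, realized as the submodule of functions
`ℂ → W` recording a homogeneous component in each weight. -/
def CGrading.compSub (G : CGrading W) : Submodule ℂ (ℂ → W) where
  carrier := {f | ∀ n, G.proj n (f n) = f n}
  add_mem' := by
    intro a b ha hb n
    simp only [Pi.add_apply, map_add, ha n, hb n]
  zero_mem' := by
    intro n
    simp
  smul_mem' := by
    intro c f hf n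
    simp only [Pi.smul_apply, map_smul, hf n]

/-- The algebraic completion of a graded space. -/
abbrev CGrading.Comp (G : CGrading W) : Type _ := ↥G.compSub

/-- The pairing between the graded dual and the algebraic completion. -/
def CGrading.pair (G : CGrading W) (φ : W →ₗ[ℂ] ℂ) (f : G.Comp) : ℂ :=
  ∑ᶠ n : ℂ, φ (f.1 n)

/-- The embedding of `W` into its algebraic completion. -/
def CGrading.emb (G : CGrading W) (w : W) : G.Comp :=
  ⟨fun n => G.proj n w, by
    intro n
    have h := congrArg (fun T : W →ₗ[ℂ] W => T w) (G.proj_comp n n)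
    simpa using h⟩

/-- The componentwise extension of an operator on `W` to the algebraic completion. -/
def CGrading.ext (G : CGrading W) (L : W → W) (f : G.Comp) : G.Comp :=
  ⟨fun m => ∑ᶠ n : ℂ, G.proj m (L (f.1 n)), by
    intro m
    show G.proj m (∑ᶠ n : ℂ, G.proj m (L (f.1 n))) = ∑ᶠ n : ℂ, G.proj m (L (f.1 n))
    by_cases h : (Function.support fun n => G.proj m (L (f.1 n))).Finite
    · have h1 := AddMonoidHom.map_finsum (G.proj m).toAddMonoidHom h
      simp only [LinearMap.toAddMonoidHom_coe] at h1
      rw [h1]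
      refine finsum_congr fun n => ?_
      have h2 := congrArg (fun T : W →ₗ[ℂ] W => T (L (f.1 n))) (G.proj_comp m m)
      simpa using h2
    · rw [finsum_of_infinite_support h]
      simp⟩

/-- The operator `z^d` on the algebraic completion, acting on the component of
weight `n` by `z ^ n` (complex power). -/
def CGrading.zd (G : CGrading W) (z : ℂ) (f : G.Comp) : G.Comp :=
  ⟨fun n => (z ^ n) • f.1 n, by
    intro n
    rw [map_smul, f.2 n]⟩

end Graded


section VOA

/-- A meromorphic open-string vertex algebra (MOSVA): a lower-bounded `ℤ`-graded
space with a vertex operator map (recorded through its coefficients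
`Y u v k = (Y_V)_k(u)v`, the coefficient of `x^{-k-1}` in `Y_V(u,x)v`) and a
vacuum, satisfying the grading, vacuum, `D`-derivative/commutator, rationality and
associativity axioms. -/
structure MOSVA (V : Type*) [AddCommGroup V] [Module ℂ V] where
  gr : ZGrading V
  Y : V →ₗ[ℂ] V →ₗ[ℂ] (ℤ → V)
  vac : V
  /-- lower truncation of vertex operators -/
  trunc : ∀ u v : V, ∃ N : ℤ, ∀ k : ℤ, N ≤ k → Y u v k = 0
  /-- identity property `Y(𝟏,x) = 1` -/
  identity : ∀ (v : V) (k : ℤ), Y vac v k = if k = -1 then v else 0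
  /-- creation property: `Y(u,x)𝟏 ∈ V[[x]]` and `lim_{x→0} Y(u,x)𝟏 = u` -/
  creation : ∀ (u : V) (k : ℤ), 0 ≤ k → Y u vac k = 0
  creation_lim : ∀ u : V, Y u vac (-1) = u
  /-- the `d`-commutator formula, written in terms of coefficients -/
  d_comm : ∀ (u v : V) (k : ℤ),
    gr.d (Y u v k) = Y (gr.d u) v k + (-(k : ℂ) - 1) • Y u v k + Y u (gr.d v) k
  /-- the `D`-derivative property (`D_V u = (Y_V)_{-2}(u)𝟏`) -/
  D_deriv : ∀ (u v : V) (k : ℤ),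
    Y (Y u vac (-2)) v k = (-(k : ℂ)) • Y u v (k - 1)
  /-- the `D`-commutator formula -/
  D_comm : ∀ (u v : V) (k : ℤ),
    Y (Y u v k) vac (-2) - Y u (Y v vac (-2)) k = (-(k : ℂ)) • Y u v (k - 1)
  /-- rationality of products: matrix coefficients of products of vertex operators
  converge absolutely in the ordered region to rational functions with the only
  possible poles at `z i = 0` and `z i = z j` -/
  rationality : ∀ (n : ℕ) (u : Fin n → V) (v : V) (φ : V →ₗ[ℂ] ℂ),
    InGradedDual gr.proj φ → ∃ R : RatFn (Fin n), ∀ z : Fin n → ℂ, OrderedPos z →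
      AbsConvTo (fun k : Fin n → ℤ =>
          φ (compApply n (fun i x => Y (u i) x (k i)) v) * ∏ i, z i ^ (-(k i) - 1))
        (R.eval z)
  /-- rationality of iterates and associativity: products and iterates converge to a
  common rational function -/
  associativity : ∀ (u₁ u₂ v : V) (φ : V →ₗ[ℂ] ℂ), InGradedDual gr.proj φ →
    ∃ R : RatFn (Fin 2),
      (∀ z₁ z₂ : ℂ, ‖z₂‖ < ‖z₁‖ → 0 < ‖z₂‖ →
        AbsConvTo (fun k : ℤ × ℤ =>
            φ (Y u₁ (Y u₂ v k.2) k.1) * z₁ ^ (-k.1 - 1) * z₂ ^ (-k.2 - 1))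
          (R.eval ![z₁, z₂])) ∧
      (∀ z₁ z₂ : ℂ, ‖z₁ - z₂‖ < ‖z₂‖ → 0 < ‖z₁ - z₂‖ →
        AbsConvTo (fun k : ℤ × ℤ =>
            φ (Y (Y u₁ u₂ k.1) v k.2) * (z₁ - z₂) ^ (-k.1 - 1) * z₂ ^ (-k.2 - 1))
          (R.eval ![z₁, z₂]))

variable {V : Type*} [AddCommGroup V] [Module ℂ V]

/-- The operator `D_V`. -/
def MOSVA.D (A : MOSVA V) (v : V) : V := A.Y v A.vac (-2)

/-- The pole-order condition for a MOSVA. -/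
def MOSVA.PoleOrder (A : MOSVA V) : Prop :=
  ∀ u₁ v : V, ∃ C : ℕ, ∀ φ : V →ₗ[ℂ] ℂ, InGradedDual A.gr.proj φ → ∀ u₂ : V,
    ∃ R : RatFn (Fin 2), R.a 0 ≤ C ∧
      ∀ z₁ z₂ : ℂ, ‖z₂‖ < ‖z₁‖ → 0 < ‖z₂‖ →
        AbsConvTo (fun k : ℤ × ℤ =>
            φ (A.Y u₁ (A.Y u₂ v k.2) k.1) * z₁ ^ (-k.1 - 1) * z₂ ^ (-k.2 - 1))
          (R.eval ![z₁, z₂])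

/-- A bimodule for a MOSVA: a `ℂ`-graded space with left and right vertex operator
maps (recorded through their coefficients), satisfying the left module, right module
and compatibility axioms. -/
structure Bimod (A : MOSVA V) (W : Type*) [AddCommGroup W] [Module ℂ W] where
  gr : CGrading W
  YL : V →ₗ[ℂ] W →ₗ[ℂ] (ℤ → W)
  YR : W →ₗ[ℂ] V →ₗ[ℂ] (ℤ → W)
  DW : W →ₗ[ℂ] W
  /-- `D_W` has weight one -/
  DW_wt : ∀ n : ℂ, DW ∘ₗ gr.proj n = gr.proj (n + 1) ∘ₗ DW ∘ₗ gr.proj n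
  truncL : ∀ (u : V) (w : W), ∃ N : ℤ, ∀ k : ℤ, N ≤ k → YL u w k = 0
  truncR : ∀ (w : W) (u : V), ∃ N : ℤ, ∀ k : ℤ, N ≤ k → YR w u k = 0
  identityL : ∀ (w : W) (k : ℤ), YL A.vac w k = if k = -1 then w else 0
  creationR : ∀ (w : W) (k : ℤ), 0 ≤ k → YR w A.vac k = 0
  creationR_lim : ∀ w : W, YR w A.vac (-1) = w
  d_commL : ∀ (u : V) (w : W) (k : ℤ),
    gr.d (YL u w k) = YL (A.gr.d u) w k + (-(k : ℂ) - 1) • YL u w k + YL u (gr.d w) k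
  d_commR : ∀ (w : W) (u : V) (k : ℤ),
    gr.d (YR w u k) = YR (gr.d w) u k + (-(k : ℂ) - 1) • YR w u k + YR w (A.gr.d u) k
  D_derivL : ∀ (u : V) (w : W) (k : ℤ),
    YL (A.D u) w k = (-(k : ℂ)) • YL u w (k - 1)
  D_commL : ∀ (u : V) (w : W) (k : ℤ),
    DW (YL u w k) - YL u (DW w) k = (-(k : ℂ)) • YL u w (k - 1)
  D_derivR : ∀ (w : W) (u : V) (k : ℤ),
    YR (DW w) u k = (-(k : ℂ)) • YR w u (k - 1)
  D_commR : ∀ (w : W) (u : V) (k : ℤ),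
    DW (YR w u k) - YR w (A.D u) k = (-(k : ℂ)) • YR w u (k - 1)
  /-- rationality for products of left vertex operators -/
  rationalityL : ∀ (n : ℕ) (u : Fin n → V) (w : W) (φ : W →ₗ[ℂ] ℂ),
    InGradedDual gr.proj φ → ∃ R : RatFn (Fin n), ∀ z : Fin n → ℂ, OrderedPos z →
      AbsConvTo (fun k : Fin n → ℤ =>
          φ (compApply n (fun i x => YL (u i) x (k i)) w) * ∏ i, z i ^ (-(k i) - 1))
        (R.eval z)
  /-- rationality of iterates and associativity for the left vertex operator map -/
  associativityL : ∀ (u₁ u₂ : V) (w : W) (φ : W →ₗ[ℂ] ℂ), InGradedDual gr.proj φ →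
    ∃ R : RatFn (Fin 2),
      (∀ z₁ z₂ : ℂ, ‖z₂‖ < ‖z₁‖ → 0 < ‖z₂‖ →
        AbsConvTo (fun k : ℤ × ℤ =>
            φ (YL u₁ (YL u₂ w k.2) k.1) * z₁ ^ (-k.1 - 1) * z₂ ^ (-k.2 - 1))
          (R.eval ![z₁, z₂])) ∧
      (∀ z₁ z₂ : ℂ, ‖z₁ - z₂‖ < ‖z₂‖ → 0 < ‖z₁ - z₂‖ →
        AbsConvTo (fun k : ℤ × ℤ =>
            φ (YL (A.Y u₁ u₂ k.1) w k.2) * (z₁ - z₂) ^ (-k.1 - 1) * z₂ ^ (-k.2 - 1))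
          (R.eval ![z₁, z₂]))
  /-- rationality for products `Y_W^R(w,z₁)Y_V(u₁,z₂)⋯Y_V(u_{n-1},z_n)u_n` -/
  rationalityR : ∀ (n : ℕ) (w : W) (v : Fin (n+1) → V) (φ : W →ₗ[ℂ] ℂ),
    InGradedDual gr.proj φ → ∃ R : RatFn (Fin (n+1)),
      ∀ z : Fin (n+1) → ℂ, OrderedPos z →
        AbsConvTo (fun k : Fin (n+1) → ℤ =>
            φ (YR w (compApply n (fun i x => A.Y (v i.castSucc) x (k i.succ))
                (v (Fin.last n))) (k 0)) * ∏ i, z i ^ (-(k i) - 1))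
          (R.eval z)
  /-- rationality of iterates and associativity for the right vertex operator map -/
  associativityR : ∀ (w : W) (u₁ u₂ : V) (φ : W →ₗ[ℂ] ℂ), InGradedDual gr.proj φ →
    ∃ R : RatFn (Fin 2),
      (∀ z₁ z₂ : ℂ, ‖z₂‖ < ‖z₁‖ → 0 < ‖z₂‖ →
        AbsConvTo (fun k : ℤ × ℤ =>
            φ (YR w (A.Y u₁ u₂ k.2) k.1) * z₁ ^ (-k.1 - 1) * z₂ ^ (-k.2 - 1))
          (R.eval ![z₁, z₂])) ∧
      (∀ z₁ z₂ : ℂ, ‖z₁ - z₂‖ < ‖z₂‖ → 0 < ‖z₁ - z₂‖ →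
        AbsConvTo (fun k : ℤ × ℤ =>
            φ (YR (YR w u₁ k.1) u₂ k.2) * (z₁ - z₂) ^ (-k.1 - 1) * z₂ ^ (-k.2 - 1))
          (R.eval ![z₁, z₂]))
  /-- compatibility: rationality of mixed products
  `Y_W^L(u₁,z₁)⋯Y_W^L(u_p,z_p)Y_W^R(w,z₀)Y_V(v₁,⋅)⋯Y_V(v_{q},⋅)v_{q+1}` -/
  compatRat : ∀ (p q : ℕ) (u : Fin p → V) (w : W) (v : Fin (q+1) → V)
      (φ : W →ₗ[ℂ] ℂ), InGradedDual gr.proj φ →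
    ∃ R : RatFn (Fin p ⊕ Fin (q+1)),
      ∀ (zL : Fin p → ℂ) (z0 : ℂ) (zR : Fin q → ℂ),
        Ordered zL → (∀ i, ‖z0‖ < ‖zL i‖) → (∀ j, ‖zR j‖ < ‖z0‖) → Ordered zR →
        0 < ‖z0‖ → (∀ j, 0 < ‖zR j‖) →
        AbsConvTo (fun K : (Fin p → ℤ) × ℤ × (Fin q → ℤ) =>
            φ (compApply p (fun i x => YL (u i) x (K.1 i))
                (YR w (compApply q (fun j x => A.Y (v j.castSucc) x (K.2.2 j))
                  (v (Fin.last q))) K.2.1))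
              * (∏ i, zL i ^ (-(K.1 i) - 1)) * z0 ^ (-K.2.1 - 1)
              * ∏ j, zR j ^ (-(K.2.2 j) - 1))
          (R.eval (Sum.elim zL (Fin.cons z0 zR)))
  /-- compatibility: associativity for the left and right vertex operator maps -/
  compatAssoc : ∀ (u v : V) (w : W) (φ : W →ₗ[ℂ] ℂ), InGradedDual gr.proj φ →
    ∃ R : RatFn (Fin 2),
      (∀ z₁ z₂ : ℂ, ‖z₂‖ < ‖z₁‖ → 0 < ‖z₂‖ →
        AbsConvTo (fun k : ℤ × ℤ =>
            φ (YL u (YR w v k.2) k.1) * z₁ ^ (-k.1 - 1) * z₂ ^ (-k.2 - 1))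
          (R.eval ![z₁, z₂])) ∧
      (∀ z₁ z₂ : ℂ, ‖z₁ - z₂‖ < ‖z₂‖ → 0 < ‖z₁ - z₂‖ →
        AbsConvTo (fun k : ℤ × ℤ =>
            φ (YR (YL u w k.1) v k.2) * (z₁ - z₂) ^ (-k.1 - 1) * z₂ ^ (-k.2 - 1))
          (R.eval ![z₁, z₂]))

variable {W : Type*} [AddCommGroup W] [Module ℂ W] {A : MOSVA V}

/-- The opposite right vertex operator map
`Y_W^{s(R)}(v,x)w = e^{xD_W}Y_W^R(w,-x)v`, through its coefficients. -/
def Bimod.YsR (B : Bimod A W) (v : V) (w : W) (k : ℤ) : W :=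
  ∑ᶠ m : ℕ, (((-1 : ℂ) ^ (k + (m : ℤ) + 1)) * ((m.factorial : ℂ))⁻¹) •
    ((B.DW ^ m) (B.YR w v (k + (m : ℤ))))

/-- The pole-order condition for a bimodule over a MOSVA. -/
def Bimod.PoleOrder (B : Bimod A W) : Prop :=
  (∀ (u₁ : V) (w : W), ∃ C : ℕ, ∀ φ : W →ₗ[ℂ] ℂ, InGradedDual B.gr.proj φ → ∀ u₂ : V,
    ∃ R : RatFn (Fin 2), R.a 0 ≤ C ∧
      ∀ z₁ z₂ : ℂ, ‖z₂‖ < ‖z₁‖ → 0 < ‖z₂‖ →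
        AbsConvTo (fun k : ℤ × ℤ =>
            φ (B.YL u₁ (B.YL u₂ w k.2) k.1) * z₁ ^ (-k.1 - 1) * z₂ ^ (-k.2 - 1))
          (R.eval ![z₁, z₂])) ∧
  (∀ (u₂ : V) (w : W), ∃ C : ℕ, ∀ φ : W →ₗ[ℂ] ℂ, InGradedDual B.gr.proj φ → ∀ u₁ : V,
    ∃ R : RatFn (Fin 2), R.a 0 ≤ C ∧
      ∀ z₁ z₂ : ℂ, ‖z₂‖ < ‖z₁‖ → 0 < ‖z₂‖ →
        AbsConvTo (fun k : ℤ × ℤ =>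
            φ (B.YR w (A.Y u₁ u₂ k.2) k.1) * z₁ ^ (-k.1 - 1) * z₂ ^ (-k.2 - 1))
          (R.eval ![z₁, z₂])) ∧
  (∀ (u₁ u₂ : V), ∃ C : ℕ, ∀ φ : W →ₗ[ℂ] ℂ, InGradedDual B.gr.proj φ → ∀ w : W,
    ∃ R : RatFn (Fin 2), R.a 0 ≤ C ∧
      ∀ z₁ z₂ : ℂ, ‖z₂‖ < ‖z₁‖ → 0 < ‖z₂‖ →
        AbsConvTo (fun k : ℤ × ℤ =>
            φ (B.YL u₁ (B.YR w u₂ k.2) k.1) * z₁ ^ (-k.1 - 1) * z₂ ^ (-k.2 - 1))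
          (R.eval ![z₁, z₂]))

end VOA


section Cochains

variable {V : Type*} [AddCommGroup V] [Module ℂ V]
variable {W : Type*} [AddCommGroup W] [Module ℂ W] {A : MOSVA V}

/-- A `W̄`-valued rational function in the variables `z i`, `i : ι`, with the only
possible poles at `z i = z j`: a map from configuration space to the algebraic
completion whose pairings with graded-dual functionals are such rational functions,
with pole orders uniform in the functional, as witnessed by a formal power series
with coefficients in `W` (condition (ii)). -/
def CGrading.WTilde (G : CGrading W) {ι : Type*} [Fintype ι] [DecidableEq ι]
    (f : (ι → ℂ) → G.Comp) : Prop :=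
  (∀ φ : W →ₗ[ℂ] ℂ, InGradedDual G.proj φ →
      ∃ R : DiagRatFn ι, ∀ z : ι → ℂ, Conf z → G.pair φ (f z) = R.eval z) ∧
  ∃ (p : ι → ι → ℤ) (b : (ι → ℕ) → W),
    ∀ φ : W →ₗ[ℂ] ℂ, InGradedDual G.proj φ →
      (Function.support fun k => φ (b k)).Finite ∧
      ∀ z : ι → ℂ, Conf z →
        (∏ q ∈ Finset.univ.offDiag, (z q.1 - z q.2) ^ (p q.1 q.2)) * G.pair φ (f z)
          = ∑ᶠ k : ι → ℕ, φ (b k) * ∏ i, z i ^ (k i)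

/-- The pattern of left/right vertex operators: the `i`-th operator is
`Y_W^L(u i, z i)` if `isL i`, and `Y_W^{s(R)}(u i, z i)` otherwise; `k` records the
coefficient extracted from each operator. -/
def patOps (B : Bimod A W) {n : ℕ} (isL : Fin n → Bool) (u : Fin n → V)
    (k : Fin n → ℤ) : Fin n → (W → W) :=
  fun i => if isL i then fun x => B.YL (u i) x (k i) else fun x => B.YsR (u i) x (k i)

/-- The pattern with `l` left operators followed by `n - l` opposite right operators. -/
def prefixPat (n l : ℕ) : Fin n → Bool := fun i => decide ((i : ℕ) < l)

/-- A vector `w` such that `Y_W^L(u,x)w ∈ W[[x]]` and `Y_W^{s(R)}(u,x)w ∈ W[[x]]`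
for every `u ∈ V`. -/
def Bimod.RegVec (B : Bimod A W) (w : W) : Prop :=
  ∀ (u : V) (k : ℤ), 0 ≤ k → B.YL u w k = 0 ∧ B.YsR u w k = 0

/-- `f` represents the `W̄`-valued rational function
`E(Y^{L/sR}(u 0, z 0)⋯Y^{L/sR}(u (n-1), z (n-1)) w)` (with the operators prescribed
by the pattern `isL`): `f` is a `W̄`-valued rational function with only diagonal
poles whose pairings are the sums of the corresponding series of matrix coefficients
on the region `|z 0| > ⋯ > |z (n-1)| > 0`. -/
def RepEPat (B : Bimod A W) {n : ℕ} (isL : Fin n → Bool) (u : Fin n → V) (w : W)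
    (f : (Fin n → ℂ) → B.gr.Comp) : Prop :=
  B.gr.WTilde f ∧
  ∀ φ : W →ₗ[ℂ] ℂ, InGradedDual B.gr.proj φ → ∀ z : Fin n → ℂ, OrderedPos z →
    AbsConvTo (fun k : Fin n → ℤ =>
        φ (compApply n (patOps B isL u k) w) * ∏ i, z i ^ (-(k i) - 1))
      (B.gr.pair φ (f z))

/-- `f` represents the `W̄`-valued rational function given by a product of groups of
vertex operators, with group `i` of size `α i` and left/right pattern `isL`;
the variables are indexed by the sigma type `(i : Fin N) × Fin (α i)`. -/
def RepESig (B : Bimod A W) {N : ℕ} (α : Fin N → ℕ)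
    (isL : (i : Fin N) → Fin (α i) → Bool)
    (u : (i : Fin N) → Fin (α i) → V) (w : W)
    (f : (((i : Fin N) × Fin (α i)) → ℂ) → B.gr.Comp) : Prop :=
  B.gr.WTilde f ∧
  ∀ φ : W →ₗ[ℂ] ℂ, InGradedDual B.gr.proj φ →
    ∀ Z : (i : Fin N) → Fin (α i) → ℂ,
      (∀ (i : Fin N) (s t : Fin (α i)), s < t → ‖Z i t‖ < ‖Z i s‖) →
      (∀ (i j : Fin N), i < j → ∀ (s : Fin (α i)) (t : Fin (α j)), ‖Z j t‖ < ‖Z i s‖) →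
      (∀ (i : Fin N) (s : Fin (α i)), 0 < ‖Z i s‖) →
      AbsConvTo (fun K : (i : Fin N) → Fin (α i) → ℤ =>
          φ (compApply N (fun i x => compApply (α i) (fun s y =>
              if isL i s then B.YL (u i s) y (K i s) else B.YsR (u i s) y (K i s)) x) w)
            * ∏ i, ∏ s, Z i s ^ (-(K i s) - 1))
        (B.gr.pair φ (f (fun q => Z q.1 q.2)))

/-- Multilinearity of a map on `n`-tuples of vectors. -/
def IsMultilinear {M : Type*} [AddCommMonoid M] [Module ℂ M] {n : ℕ}
    (Φ : (Fin n → V) → M) : Prop :=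
  (∀ (v : Fin n → V) (i : Fin n) (x y : V),
      Φ (Function.update v i (x + y)) = Φ (Function.update v i x) + Φ (Function.update v i y)) ∧
  ∀ (v : Fin n → V) (i : Fin n) (c : ℂ) (x : V),
      Φ (Function.update v i (c • x)) = c • Φ (Function.update v i x)

/-- The `D`-derivative property of a map `Φ : V^{⊗n} → W̃_{z₁,…,zₙ}`. -/
def DDerivProp (A : MOSVA V) (B : Bimod A W) {n : ℕ}
    (Φ : (Fin n → V) → (Fin n → ℂ) → B.gr.Comp) : Prop :=
  (∀ (v : Fin n → V) (i : Fin n) (φ : W →ₗ[ℂ] ℂ), InGradedDual B.gr.proj φ →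
    ∀ z : Fin n → ℂ, Conf z →
      HasDerivAt (fun t : ℂ => B.gr.pair φ (Φ v (Function.update z i t)))
        (B.gr.pair φ (Φ (Function.update v i (A.D (v i))) z)) (z i)) ∧
  (∀ (v : Fin n → V) (φ : W →ₗ[ℂ] ℂ), InGradedDual B.gr.proj φ →
    ∀ z : Fin n → ℂ, Conf z →
      B.gr.pair φ (B.gr.ext (⇑B.DW) (Φ v z)) =
        ∑ i, B.gr.pair φ (Φ (Function.update v i (A.D (v i))) z))

/-- The `d`-conjugation property of a map `Φ : V^{⊗n} → W̃_{z₁,…,zₙ}`. -/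
def DConjProp (A : MOSVA V) (B : Bimod A W) {n : ℕ}
    (Φ : (Fin n → V) → (Fin n → ℂ) → B.gr.Comp) : Prop :=
  ∀ (v : Fin n → V) (φ : W →ₗ[ℂ] ℂ), InGradedDual B.gr.proj φ →
    ∀ (z : Fin n → ℂ) (c : ℂ), c ≠ 0 → Conf z → Conf (fun i => c * z i) →
      B.gr.pair φ (B.gr.zd c (Φ v z)) =
        B.gr.pair φ (Φ (fun i => A.gr.zd c (v i)) (fun i => c * z i))

/-- Composability of `Φ : V^{⊗n} → W̃` with `m` vertex operators. -/
def ComposableWith (A : MOSVA V) (B : Bimod A W) (n m : ℕ)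
    (Φ : (Fin n → V) → (Fin n → ℂ) → B.gr.Comp) : Prop :=
  ∃ Cb : V → V → ℕ,
  ∀ (α : Fin (n+1) → ℕ), (∑ i, α i) = m + n →
  ∀ l₀ : ℕ, l₀ ≤ α 0 →
  ∀ u : (i : Fin (n+1)) → Fin (α i) → V,
  ∀ φ : W →ₗ[ℂ] ℂ, InGradedDual B.gr.proj φ →
  ∃ R : DiagRatFn ((i : Fin (n+1)) × Fin (α i)),
    (∀ q q' : (i : Fin (n+1)) × Fin (α i), R.b q q' ≤ Cb (u q.1 q.2) (u q'.1 q'.2)) ∧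
    ∀ (z : (i : Fin (n+1)) → Fin (α i) → ℂ) (ζ : Fin n → ℂ),
      (∀ s t : Fin (α 0), s < t → ‖z 0 t‖ < ‖z 0 s‖) →
      (∀ (j : Fin (α 0)) (i : Fin n) (t : Fin (α i.succ)),
          ‖ζ i‖ + ‖z i.succ t - ζ i‖ < ‖z 0 j‖) →
      (∀ (i : Fin n) (s t : Fin (α i.succ)), s < t →
          ‖z i.succ t - ζ i‖ < ‖z i.succ s - ζ i‖) →
      (∀ (i j : Fin n), i < j → ∀ (s : Fin (α i.succ)) (t : Fin (α j.succ)),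
          ‖(z i.succ s - ζ i) - (z j.succ t - ζ j)‖ < ‖ζ i - ζ j‖) →
      AbsConvTo (fun K : (i : Fin (n+1)) → Fin (α i) → ℤ =>
          B.gr.pair φ
            (compApply (α 0) (fun j => B.gr.ext (fun x =>
                if (j : ℕ) < l₀ then B.YL (u 0 j) x (K 0 j) else B.YsR (u 0 j) x (K 0 j)))
              (Φ (fun i => compApply (α i.succ)
                    (fun s x => A.Y (u i.succ s) x (K i.succ s)) A.vac) ζ))
            * (∏ j, z 0 j ^ (-(K 0 j) - 1))
            * ∏ i : Fin n, ∏ s, (z i.succ s - ζ i) ^ (-(K i.succ s) - 1))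
        (R.eval (fun q => z q.1 q.2))

/-- The set `Ĉ^n_m(V,W)`: maps `V^{⊗n} → W̃_{z₁,…,zₙ}` that are linear, satisfy the
`D`-derivative and `d`-conjugation properties and are composable with `m` vertex
operators. -/
def IsCochain (A : MOSVA V) (B : Bimod A W) (n m : ℕ)
    (Φ : (Fin n → V) → (Fin n → ℂ) → B.gr.Comp) : Prop :=
  IsMultilinear Φ ∧ (∀ v, B.gr.WTilde (Φ v)) ∧ DDerivProp A B Φ ∧ DConjProp A B Φ ∧
    ComposableWith A B n m Φ

/-- `Ψ` represents `E_W^{(1,0)} ∘₂ Φ`, i.e. the map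
`v ↦ E(Y_W^L(v 0, z 0) Φ(v 1 ⊗ ⋯ ⊗ v n)(z 1,…,z n))`. -/
def RepLeft (A : MOSVA V) (B : Bimod A W) {n : ℕ}
    (Φ : (Fin n → V) → (Fin n → ℂ) → B.gr.Comp)
    (Ψ : (Fin (n+1) → V) → (Fin (n+1) → ℂ) → B.gr.Comp) : Prop :=
  (∀ v, B.gr.WTilde (Ψ v)) ∧
  ∀ (v : Fin (n+1) → V) (φ : W →ₗ[ℂ] ℂ), InGradedDual B.gr.proj φ →
    ∀ (z₀ : ℂ) (zt : Fin n → ℂ), Conf (Fin.cons z₀ zt) →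
      (∀ i, ‖zt i‖ < ‖z₀‖) → (∀ i, 0 < ‖zt i‖) →
      AbsConvTo (fun k : ℤ =>
          B.gr.pair φ (B.gr.ext (fun x => B.YL (v 0) x k) (Φ (Fin.tail v) zt))
            * z₀ ^ (-k - 1))
        (B.gr.pair φ (Ψ v (Fin.cons z₀ zt)))

/-- `Ψ` represents `E_W^{(0,1)} ∘₂ Φ`, i.e. the map
`v ↦ E(Y_W^{s(R)}(v (n+1), z (n+1)) Φ(v 1 ⊗ ⋯ ⊗ v n)(z 1,…,z n))`. -/
def RepRight (A : MOSVA V) (B : Bimod A W) {n : ℕ}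
    (Φ : (Fin n → V) → (Fin n → ℂ) → B.gr.Comp)
    (Ψ : (Fin (n+1) → V) → (Fin (n+1) → ℂ) → B.gr.Comp) : Prop :=
  (∀ v, B.gr.WTilde (Ψ v)) ∧
  ∀ (v : Fin (n+1) → V) (φ : W →ₗ[ℂ] ℂ), InGradedDual B.gr.proj φ →
    ∀ (zl : ℂ) (zi : Fin n → ℂ), Conf (Fin.snoc zi zl) →
      (∀ i, ‖zi i‖ < ‖zl‖) → (∀ i, 0 < ‖zi i‖) →
      AbsConvTo (fun k : ℤ =>
          B.gr.pair φ (B.gr.ext (fun x => B.YsR (v (Fin.last n)) x k) (Φ (Fin.init v) zi))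
            * zl ^ (-k - 1))
        (B.gr.pair φ (Ψ v (Fin.snoc zi zl)))

/-- Replace the two adjacent entries `i, i+1` of an `(n+1)`-tuple by a single entry. -/
def mergeAt {M : Type*} {n : ℕ} (i : Fin n) (v : Fin (n+1) → M) (a : M) : Fin n → M :=
  fun j => if j < i then v j.castSucc else if j = i then a else v j.succ

/-- `Ψ` represents `Φ ∘ᵢ E_V^{(2)}`, i.e. the map
`v ↦ E(Φ(v 1 ⊗ ⋯ ⊗ Y_V(v i, z i − ζ)Y_V(v (i+1), z (i+1) − ζ)𝟏 ⊗ ⋯ ⊗ v (n+1))(…,ζ,…))`. -/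
def RepCirc (A : MOSVA V) (B : Bimod A W) {n : ℕ} (i : Fin n)
    (Φ : (Fin n → V) → (Fin n → ℂ) → B.gr.Comp)
    (Ψ : (Fin (n+1) → V) → (Fin (n+1) → ℂ) → B.gr.Comp) : Prop :=
  (∀ v, B.gr.WTilde (Ψ v)) ∧
  ∀ (v : Fin (n+1) → V) (φ : W →ₗ[ℂ] ℂ), InGradedDual B.gr.proj φ →
    ∀ (z : Fin (n+1) → ℂ) (ζ : ℂ), Conf z → Conf (mergeAt i z ζ) →
      ‖z i.succ - ζ‖ < ‖z i.castSucc - ζ‖ → 0 < ‖z i.succ - ζ‖ →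
      (∀ j : Fin (n+1), j ≠ i.castSucc → j ≠ i.succ →
        ‖z i.castSucc - ζ‖ < ‖z j - z i.castSucc‖ ∧ ‖z i.succ - ζ‖ < ‖z j - z i.succ‖) →
      AbsConvTo (fun k : ℤ × ℤ =>
          B.gr.pair φ
            (Φ (mergeAt i v (A.Y (v i.castSucc) (A.Y (v i.succ) A.vac k.2) k.1))
              (mergeAt i z ζ))
            * (z i.castSucc - ζ) ^ (-k.1 - 1) * (z i.succ - ζ) ^ (-k.2 - 1))
        (B.gr.pair φ (Ψ v z))

/-- `Ψ` represents the coboundary `δ̂Φ = E_W^{(1,0)}∘₂Φ + Σᵢ (−1)^i Φ∘ᵢE_V^{(2)}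
+ (−1)^{n+1} E_W^{(0,1)}∘₂Φ` of the `n`-cochain `Φ`. -/
def IsDelta (A : MOSVA V) (B : Bimod A W) {n : ℕ}
    (Φ : (Fin n → V) → (Fin n → ℂ) → B.gr.Comp)
    (Ψ : (Fin (n+1) → V) → (Fin (n+1) → ℂ) → B.gr.Comp) : Prop :=
  ∃ (gL gR : (Fin (n+1) → V) → (Fin (n+1) → ℂ) → B.gr.Comp)
    (gC : Fin n → (Fin (n+1) → V) → (Fin (n+1) → ℂ) → B.gr.Comp),
    RepLeft A B Φ gL ∧ RepRight A B Φ gR ∧ (∀ i, RepCirc A B i Φ (gC i)) ∧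
    ∀ v z, Ψ v z = gL v z + (∑ i : Fin n, ((-1 : ℂ) ^ ((i : ℕ) + 1)) • gC i v z)
      + ((-1 : ℂ) ^ (n + 1)) • gR v z

end Cochains


/-! ### Series expansions in two variables -/

theorem absConvTo_iff_hasSum {ι : Type*} (f : ι → ℂ) (s : ℂ) : AbsConvTo f s ↔ HasSum f s :=
  ⟨fun h => h.2, fun h => ⟨h.summable.norm, h⟩⟩

theorem hasSum_congr_of_eq {ι α : Type*} [AddCommMonoid α] [TopologicalSpace α] {f g : ι → α}
    {a b : α} (h : HasSum f a) (hf : ∀ i, g i = f i) (ha : b = a) : HasSum g b := by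
  rw [ha, funext hf]
  exact h

/-- The generalized binomial coefficient `k choose i`, as a complex number. -/
def binom (k : ℤ) (i : ℕ) : ℂ := (∏ j ∈ Finset.range i, ((k : ℂ) - (j : ℂ))) / (i.factorial : ℂ)

theorem binom_natCast_add (q i : ℕ) : binom ((q : ℤ) + i) i = ((i + q).choose q : ℂ) := by
  have hi : (i.factorial : ℂ) ≠ 0 := by exact_mod_cast i.factorial_ne_zero
  have h := descPochhammer_eval_eq_descFactorial ℂ (i + q) i
  rw [descPochhammer_eval_eq_prod_range, Nat.descFactorial_eq_factorial_mul_choose,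
    Nat.choose_symm_add] at h
  rw [binom, div_eq_iff hi]
  push_cast at h ⊢
  rw [add_comm (q : ℂ), h]
  ring

theorem binom_negSucc_add (q i : ℕ) :
    binom (Int.negSucc q + i) i = (-1) ^ i * (q.choose i : ℂ) := by
  have hi : (i.factorial : ℂ) ≠ 0 := by exact_mod_cast i.factorial_ne_zero
  have h := descPochhammer_eval_eq_descFactorial ℂ q i
  rw [descPochhammer_eval_eq_prod_range, Nat.descFactorial_eq_factorial_mul_choose] at h
  rw [binom, div_eq_iff hi]
  push_cast at h
  rw [mul_assoc, mul_comm (q.choose i : ℂ), ← h, ← Finset.prod_range_reflect]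
  have hsign : (-1 : ℂ) ^ i = ∏ _j ∈ Finset.range i, (-1 : ℂ) := by simp
  rw [hsign, ← Finset.prod_mul_distrib]
  refine Finset.prod_congr rfl fun j hj => ?_
  have hj' := Finset.mem_range.1 hj
  rw [Int.negSucc_eq, Nat.sub_sub, Nat.cast_sub (by omega)]
  push_cast
  ring

theorem hasSum_choose_mul_zpow {𝕜 : Type*} [NormedField 𝕜] (q : ℕ) (a b : 𝕜)
    (h : ‖b‖ < ‖a‖) :
    HasSum (fun i : ℕ => ((i + q).choose q : 𝕜) * a ^ (-(q : ℤ) - 1 - i) * b ^ i)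
      ((a - b) ^ (-(q : ℤ) - 1)) := by
  have ha : a ≠ 0 := norm_pos_iff.1 ((norm_nonneg b).trans_lt h)
  have hab : ‖b / a‖ < 1 := by
    rw [norm_div, div_lt_one (norm_pos_iff.2 ha)]; exact h
  have h1 : a - b ≠ 0 := by
    rintro h0
    rw [sub_eq_zero.1 h0] at h
    exact lt_irrefl _ h
  have key := (hasSum_choose_mul_geometric_of_norm_lt_one q hab).mul_left (a ^ (-(q : ℤ) - 1))
  refine hasSum_congr_of_eq key (fun i => ?_) ?_
  · rw [zpow_sub₀ ha, zpow_natCast, div_pow]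
    ring
  · have e : (-(q : ℤ) - 1) = -((q + 1 : ℕ) : ℤ) := by push_cast; ring
    have h2 : 1 - b / a = (a - b) / a := by field_simp
    rw [h2, e, zpow_neg, zpow_neg, zpow_natCast, zpow_natCast, div_pow]
    have := pow_ne_zero (q + 1) ha
    have := pow_ne_zero (q + 1) h1
    field_simp

theorem hasSum_choose_mul_zpow_sub {𝕜 : Type*} [NormedField 𝕜] (q : ℕ) (a b : 𝕜) :
    HasSum (fun i : ℕ => (q.choose i : 𝕜) * a ^ ((q : ℤ) - i) * b ^ i) ((a + b) ^ q) := by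
  rw [add_comm, add_pow]
  have : ∑ m ∈ Finset.range (q + 1), b ^ m * a ^ (q - m) * (q.choose m : 𝕜) =
      ∑ i ∈ Finset.range (q + 1), (q.choose i : 𝕜) * a ^ ((q : ℤ) - i) * b ^ i := by
    refine Finset.sum_congr rfl fun i hi => ?_
    have hi' := Finset.mem_range_succ_iff.1 hi
    rw [← Nat.cast_sub hi', zpow_natCast]
    ring
  rw [this]
  refine hasSum_sum_of_ne_finset_zero fun i hi => ?_
  rw [Finset.mem_range, not_lt] at hi
  rw [Nat.choose_eq_zero_of_lt (by omega)]
  simp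

theorem hasSum_binom_mul_zpow (n : ℤ) (a b : ℂ) (h : ‖b‖ < ‖a‖) :
    HasSum (fun i : ℕ => binom (n + i) i * a ^ (-n - 1 - i) * b ^ i) ((a - b) ^ (-n - 1)) := by
  cases n with
  | ofNat q =>
    simpa only [Int.ofNat_eq_natCast, binom_natCast_add] using hasSum_choose_mul_zpow q a b h
  | negSucc q =>
    have := hasSum_choose_mul_zpow_sub q a (-b)
    have e : -Int.negSucc q - 1 = (q : ℤ) := by rw [Int.negSucc_eq]; ring
    rw [e, zpow_natCast, sub_eq_add_neg]
    refine hasSum_congr_of_eq this (fun i => ?_) rfl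
    rw [binom_negSucc_add, neg_pow b]
    ring

theorem summable_norm_binom_mul_zpow (n : ℤ) (a b : ℂ) (h : ‖b‖ < ‖a‖) :
    Summable (fun i : ℕ => ‖binom (n + i) i * a ^ (-n - 1 - i) * b ^ i‖) :=
  (hasSum_binom_mul_zpow n a b h).summable.norm

theorem tsum_norm_binom_mul_zpow_le (n : ℤ) (a b : ℂ) (h : ‖b‖ < ‖a‖) :
    ∑' i : ℕ, ‖binom (n + i) i * a ^ (-n - 1 - i) * b ^ i‖ ≤
      (‖a‖ - ‖b‖) ^ (-n - 1) + (‖a‖ + ‖b‖) ^ (-n - 1) := by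
  have h1 : 0 ≤ (‖a‖ - ‖b‖) ^ (-n - 1) := zpow_nonneg (by linarith) _
  have h2 : 0 ≤ (‖a‖ + ‖b‖) ^ (-n - 1) := by positivity
  cases n with
  | ofNat q =>
    have := hasSum_choose_mul_zpow q ‖a‖ ‖b‖ (by simpa using h)
    have e : (fun i : ℕ => ‖binom (Int.ofNat q + i) i * a ^ (-Int.ofNat q - 1 - i) * b ^ i‖) =
        fun i : ℕ => ((i + q).choose q : ℝ) * ‖a‖ ^ (-(q : ℤ) - 1 - i) * ‖b‖ ^ i := by
      funext i
      simp [binom_natCast_add]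
    rw [e, this.tsum_eq]
    simpa using h2
  | negSucc q =>
    have := hasSum_choose_mul_zpow_sub q ‖a‖ ‖b‖
    have e1 : -Int.negSucc q - 1 = (q : ℤ) := by rw [Int.negSucc_eq]; ring
    rw [e1] at h1 h2 ⊢
    have e : (fun i : ℕ => ‖binom (Int.negSucc q + i) i * a ^ ((q : ℤ) - i) * b ^ i‖) =
        fun i : ℕ => (q.choose i : ℝ) * ‖a‖ ^ ((q : ℤ) - i) * ‖b‖ ^ i := by
      funext i
      simp [binom_negSucc_add]
    rw [e, this.tsum_eq]
    simpa using h1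

theorem neg_zpow_neg_sub_one (z : ℂ) (k : ℤ) :
    (-z) ^ (-k - 1) = (-1) ^ (k + 1) * z ^ (-k - 1) := by
  rw [← neg_one_mul, mul_zpow]
  congr 1
  rw [← inv_neg_one, inv_zpow', inv_neg_one]
  congr 1
  ring

/-- Substituting `x₁ = z₁ - z₂`, `x₂ = -z₂` into a doubly infinite series, with powers of
`z₁ - z₂` expanded in nonnegative powers of `z₂`. -/
theorem hasSum_subst_sub {g c : ℤ × ℤ → ℂ} {F : ℂ → ℂ → ℂ}
    (hg : ∀ z₁ z₂ : ℂ, ‖z₂‖ < ‖z₁‖ → 0 < ‖z₂‖ →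
      HasSum (fun k : ℤ × ℤ => g k * z₁ ^ (-k.1 - 1) * z₂ ^ (-k.2 - 1)) (F z₁ z₂))
    (hc : ∀ k : ℤ × ℤ, HasSum (fun i : ℕ =>
      (-1) ^ (k.2 + i + 1) * binom k.1 i * g (k.1 - i, k.2 + i)) (c k))
    {z₁ z₂ : ℂ} (h : 2 * ‖z₂‖ < ‖z₁‖) (h0 : 0 < ‖z₂‖) :
    HasSum (fun k : ℤ × ℤ => c k * z₁ ^ (-k.1 - 1) * z₂ ^ (-k.2 - 1)) (F (z₁ - z₂) (-z₂)) := by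
  have h12 : ‖z₂‖ < ‖z₁‖ := by linarith
  have hz1 : z₁ ≠ 0 := norm_pos_iff.1 (h0.trans h12)
  have hz2 : z₂ ≠ 0 := norm_pos_iff.1 h0
  set T : (ℤ × ℤ) × ℕ → ℂ := fun p => (g p.1 * (-z₂) ^ (-p.1.2 - 1)) *
    (binom (p.1.1 + p.2) p.2 * z₁ ^ (-p.1.1 - 1 - p.2) * z₂ ^ p.2) with hT
  have hTs : Summable T := by
    rw [← summable_norm_iff, summable_prod_of_nonneg (fun _ => norm_nonneg _)]
    constructor
    · intro k
      simp only [hT, norm_mul (g k * _)]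
      exact (summable_norm_binom_mul_zpow k.1 z₁ z₂ h12).mul_left _
    · have hx : ∀ x : ℝ, ‖z₂‖ < x →
          Summable fun k : ℤ × ℤ => ‖g k * (-z₂) ^ (-k.2 - 1)‖ * x ^ (-k.1 - 1) := by
        intro x hx
        have hx0 : 0 < x := h0.trans hx
        have := (hg (x : ℂ) (-z₂) (by simpa [abs_of_pos hx0] using hx)
          (by simpa using hz2)).summable.norm
        refine this.congr fun k => ?_
        simp only [norm_mul, norm_zpow, Complex.norm_real, Real.norm_eq_abs, abs_of_pos hx0]
        ring
      refine Summable.of_nonneg_of_le (fun k => tsum_nonneg fun _ => norm_nonneg _) (fun k => ?_)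
        ((hx (‖z₁‖ - ‖z₂‖) (by linarith)).add (hx (‖z₁‖ + ‖z₂‖) (by linarith)))
      simp only [hT, norm_mul (g k * _)]
      rw [tsum_mul_left, ← mul_add]
      exact mul_le_mul_of_nonneg_left (tsum_norm_binom_mul_zpow_le k.1 z₁ z₂ h12)
        (norm_nonneg _)
  have hsum : HasSum T (F (z₁ - z₂) (-z₂)) := by
    have h1 := hTs.hasSum.prod_fiberwise fun k =>
      (hasSum_binom_mul_zpow k.1 z₁ z₂ h12).mul_left (g k * (-z₂) ^ (-k.2 - 1))
    have hlt : ‖-z₂‖ < ‖z₁ - z₂‖ := by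
      rw [norm_neg]
      linarith [norm_sub_norm_le z₁ z₂]
    have h2 := hg (z₁ - z₂) (-z₂) hlt (by simpa using hz2)
    have h3 : (∑' p, T p) = F (z₁ - z₂) (-z₂) := by
      refine h1.unique ?_
      exact hasSum_congr_of_eq h2 (fun k => by ring) rfl
    exact h3 ▸ hTs.hasSum
  let e : (ℤ × ℤ) × ℕ ≃ (ℤ × ℤ) × ℕ :=
    { toFun := fun p => ((p.1.1 - p.2, p.1.2 + p.2), p.2)
      invFun := fun p => ((p.1.1 + p.2, p.1.2 - p.2), p.2)
      left_inv := fun p => by simp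
      right_inv := fun p => by simp }
  have he := (e.hasSum_iff).2 hsum
  refine he.prod_fiberwise fun k => ?_
  have := ((hc k).mul_right (z₁ ^ (-k.1 - 1))).mul_right (z₂ ^ (-k.2 - 1))
  refine hasSum_congr_of_eq this (fun i => ?_) rfl
  simp only [hT, e, Function.comp, Equiv.coe_fn_mk, sub_add_cancel]
  have e1 : (-z₂) ^ (-(k.2 + (i : ℤ)) - 1) =
      (-1) ^ (k.2 + i + 1) * (z₂ ^ (-k.2 - 1) * (z₂ ^ i)⁻¹) := by
    rw [neg_zpow_neg_sub_one, ← zpow_natCast z₂ i, ← zpow_neg, ← zpow_add₀ hz2]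
    congr 2
    ring
  have e2 : -(k.1 - (i : ℤ)) - 1 - i = -k.1 - 1 := by ring
  have hzi : z₂ ^ i ≠ 0 := pow_ne_zero _ hz2
  rw [e1, e2]
  field_simp

theorem integral_exp_int_mul_I (m : ℤ) :
    ∫ t in (0 : ℝ)..(2 * Real.pi), Complex.exp ((m * Complex.I) * (t : ℂ)) =
      if m = 0 then 2 * (Real.pi : ℂ) else 0 := by
  split_ifs with h
  · simp [h]
  · rw [integral_exp_mul_complex (by simp [h])]
    have : Complex.exp (m * Complex.I * ((2 * Real.pi : ℝ) : ℂ)) = 1 := by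
      rw [← Complex.exp_int_mul_two_pi_mul_I m]
      congr 1
      push_cast
      ring
    rw [this]
    simp

/-- Uniqueness of Laurent coefficients on a circle. -/
theorem laurent_coeff_eq_zero {c : ℤ → ℂ} {r : ℝ} (hr : 0 < r)
    (h : ∀ z : ℂ, ‖z‖ = r → HasSum (fun k : ℤ => c k * z ^ (-k - 1)) 0) (n : ℤ) : c n = 0 := by
  have hr' : (r : ℂ) ≠ 0 := by exact_mod_cast hr.ne'
  have hz : ∀ t : ℝ, ‖(r : ℂ) * Complex.exp (t * Complex.I)‖ = r := fun t => by
    rw [norm_mul, Complex.norm_exp_ofReal_mul_I, mul_one, Complex.norm_real, Real.norm_eq_abs,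
      abs_of_pos hr]
  set F : ℤ → ℝ → ℂ := fun k t =>
    c k * (r : ℂ) ^ (-k - 1) * Complex.exp (((n - k : ℤ) * Complex.I) * (t : ℂ)) with hF
  have hnorm : ∀ k t, ‖F k t‖ = ‖c k * (r : ℂ) ^ (-k - 1)‖ := by
    intro k t
    have : (((n - k : ℤ) : ℂ) * Complex.I) * (t : ℂ) =
        (((n - k : ℤ) * t : ℝ) : ℂ) * Complex.I := by push_cast; ring
    rw [hF]
    simp only
    rw [this, norm_mul _ (Complex.exp _), Complex.norm_exp_ofReal_mul_I, mul_one]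
  have hs : Summable fun k => ‖c k * (r : ℂ) ^ (-k - 1)‖ :=
    (h r (by simp [abs_of_pos hr])).summable.norm
  have key := intervalIntegral.hasSum_integral_of_dominated_convergence
    (μ := MeasureTheory.volume) (a := 0) (b := 2 * Real.pi) (F := F) (f := fun _ => 0)
    (fun k _ => ‖c k * (r : ℂ) ^ (-k - 1)‖)
    (fun k => by
      apply Continuous.aestronglyMeasurable
      fun_prop)
    (fun k => Filter.Eventually.of_forall fun t _ => (hnorm k t).le)
    (Filter.Eventually.of_forall fun t _ => hs)
    (by simp)
    (Filter.Eventually.of_forall fun t _ => by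
      have := (h _ (hz t)).mul_right (Complex.exp (((n + 1 : ℤ) * Complex.I) * (t : ℂ)))
      rw [zero_mul] at this
      refine hasSum_congr_of_eq this (fun k => ?_) rfl
      rw [hF]
      simp only
      rw [mul_zpow, ← Complex.exp_int_mul, mul_assoc (c k), mul_assoc (c k), mul_assoc (_ ^ _),
        ← Complex.exp_add]
      congr 3
      push_cast
      ring)
  have hint : ∀ k, ∫ t in (0 : ℝ)..(2 * Real.pi), F k t =
      if k = n then c n * (r : ℂ) ^ (-n - 1) * (2 * Real.pi) else 0 := by
    intro k
    rw [hF]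
    simp only
    rw [intervalIntegral.integral_const_mul, integral_exp_int_mul_I]
    by_cases hk : k = n
    · simp [hk]
    · have : n - k ≠ 0 := sub_ne_zero.2 (Ne.symm hk)
      simp [hk, this]
  simp only [hint, intervalIntegral.integral_zero] at key
  have := key.unique (hasSum_ite_eq n _)
  have hpi : (2 * (Real.pi : ℂ)) ≠ 0 := by simp [Real.pi_ne_zero]
  rcases mul_eq_zero.1 this.symm with h1 | h1
  · exact (mul_eq_zero.1 h1).resolve_right (zpow_ne_zero _ hr')
  · exact absurd h1 hpi

/-- Uniqueness of Laurent coefficients on a torus. -/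
theorem laurent_coeff_unique {c d : ℤ × ℤ → ℂ} {F : ℂ → ℂ → ℂ} {r₁ r₂ : ℝ}
    (hr₁ : 0 < r₁) (hr₂ : 0 < r₂)
    (hc : ∀ z₁ z₂ : ℂ, ‖z₁‖ = r₁ → ‖z₂‖ = r₂ →
      HasSum (fun k : ℤ × ℤ => c k * z₁ ^ (-k.1 - 1) * z₂ ^ (-k.2 - 1)) (F z₁ z₂))
    (hd : ∀ z₁ z₂ : ℂ, ‖z₁‖ = r₁ → ‖z₂‖ = r₂ →
      HasSum (fun k : ℤ × ℤ => d k * z₁ ^ (-k.1 - 1) * z₂ ^ (-k.2 - 1)) (F z₁ z₂)) : c = d := by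
  have hs : ∀ z₁ z₂ : ℂ, ‖z₁‖ = r₁ → ‖z₂‖ = r₂ →
      HasSum (fun k : ℤ × ℤ => (c k - d k) * z₁ ^ (-k.1 - 1) * z₂ ^ (-k.2 - 1)) 0 := by
    intro z₁ z₂ h1 h2
    have := (hc z₁ z₂ h1 h2).sub (hd z₁ z₂ h1 h2)
    rw [sub_self] at this
    exact hasSum_congr_of_eq this (fun k => by ring) rfl
  have hfib : ∀ (k₁ : ℤ) (z₂ : ℂ), ‖z₂‖ = r₂ →
      Summable fun k₂ : ℤ => (c (k₁, k₂) - d (k₁, k₂)) * z₂ ^ (-k₂ - 1) := by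
    intro k₁ z₂ h2
    have hne : (r₁ : ℂ) ^ (-k₁ - 1) ≠ 0 := zpow_ne_zero _ (by exact_mod_cast hr₁.ne')
    have := (hs r₁ z₂ (by simp [abs_of_pos hr₁]) h2).summable.prod_factor k₁
    refine (this.mul_left ((r₁ : ℂ) ^ (-k₁ - 1))⁻¹).congr fun k₂ => ?_
    field_simp
  funext k
  rw [← sub_eq_zero]
  refine laurent_coeff_eq_zero (c := fun k₂ => c (k.1, k₂) - d (k.1, k₂)) hr₂ (fun z₂ h2 => ?_) k.2
  have h0 := laurent_coeff_eq_zero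
    (c := fun k₁ => ∑' k₂ : ℤ, (c (k₁, k₂) - d (k₁, k₂)) * z₂ ^ (-k₂ - 1)) hr₁ (fun z₁ h1 => by
      refine (hs z₁ z₂ h1 h2).prod_fiberwise fun k₁ => ?_
      exact hasSum_congr_of_eq ((hfib k₁ z₂ h2).hasSum.mul_right (z₁ ^ (-k₁ - 1)))
        (fun k₂ => by ring) rfl) k.1
  exact h0 ▸ (hfib k.1 z₂ h2).hasSum

/-! ### Rational functions in two variables -/

/-- `F` agrees, away from `z₁ = 0`, `z₂ = 0` and `z₁ = z₂`, with a rational function whose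
only possible poles lie there. -/
def IsRational (F : ℂ → ℂ → ℂ) : Prop :=
  ∃ (p : MvPolynomial (Fin 2) ℂ) (a b c : ℕ), ∀ z₁ z₂ : ℂ, z₁ ≠ 0 → z₂ ≠ 0 → z₁ ≠ z₂ →
    F z₁ z₂ = MvPolynomial.eval ![z₁, z₂] p / (z₁ ^ a * z₂ ^ b * (z₁ - z₂) ^ c)

theorem RatFn.eval_two (R : RatFn (Fin 2)) (z₁ z₂ : ℂ) :
    R.eval ![z₁, z₂] = MvPolynomial.eval ![z₁, z₂] R.num /
      (z₁ ^ R.a 0 * z₂ ^ R.a 1 * ((z₁ - z₂) ^ R.b 0 1 * (z₂ - z₁) ^ R.b 1 0)) := by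
  have h : (Finset.univ : Finset (Fin 2)).offDiag = {(0, 1), (1, 0)} := by decide
  rw [RatFn.eval, h, Finset.prod_pair (by decide), Fin.prod_univ_two]
  simp

theorem IsRational.exists_ratFn {F : ℂ → ℂ → ℂ} (hF : IsRational F) :
    ∃ R : RatFn (Fin 2), ∀ z₁ z₂ : ℂ, z₁ ≠ 0 → z₂ ≠ 0 → z₁ ≠ z₂ →
      F z₁ z₂ = R.eval ![z₁, z₂] := by
  obtain ⟨p, a, b, c, h⟩ := hF
  refine ⟨⟨p, ![a, b], ![![0, c], ![0, 0]]⟩, fun z₁ z₂ h1 h2 h3 => ?_⟩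
  rw [h z₁ z₂ h1 h2 h3, RatFn.eval_two]
  simp

theorem isRational_eval_sub_neg (R : RatFn (Fin 2)) :
    IsRational fun z₁ z₂ => R.eval ![z₁ - z₂, -z₂] := by
  refine ⟨MvPolynomial.C ((-1) ^ R.a 1 * (-1) ^ R.b 1 0) *
    MvPolynomial.bind₁ ![MvPolynomial.X 0 - MvPolynomial.X 1, -MvPolynomial.X 1] R.num,
    R.b 0 1 + R.b 1 0, R.a 1, R.a 0, fun z₁ z₂ h1 h2 h3 => ?_⟩
  have e : MvPolynomial.eval ![z₁, z₂] (MvPolynomial.bind₁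
      ![MvPolynomial.X 0 - MvPolynomial.X 1, -MvPolynomial.X 1] R.num) =
      MvPolynomial.eval ![z₁ - z₂, -z₂] R.num := by
    rw [← MvPolynomial.coe_aeval_eq_eval, ← MvPolynomial.coe_aeval_eq_eval]
    simp only [RingHom.coe_coe]
    rw [MvPolynomial.aeval_bind₁]
    congr 2
    funext i
    fin_cases i <;> simp
  have h12 : z₁ - z₂ ≠ 0 := sub_ne_zero.2 h3
  have hs : ∀ n : ℕ, ((-1 : ℂ) ^ n) * (-1) ^ n = 1 := fun n => by
    rw [← mul_pow]; simp
  change R.eval ![z₁ - z₂, -z₂] = _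
  rw [RatFn.eval_two, map_mul, MvPolynomial.eval_C, e, div_eq_div_iff]
  · have e1 : z₁ - z₂ - -z₂ = z₁ := by ring
    have e2 : -z₂ - (z₁ - z₂) = -1 * z₁ := by ring
    have e3 : -z₂ = -1 * z₂ := by ring
    rw [e1, e2, e3, mul_pow, mul_pow, pow_add]
    linear_combination (-(MvPolynomial.eval ![z₁ - z₂, -1 * z₂] R.num * z₁ ^ R.b 0 1 * z₁ ^ R.b 1 0 *
      z₂ ^ R.a 1 * (z₁ - z₂) ^ R.a 0)) * (hs (R.a 1) * ((-1) ^ R.b 1 0 * (-1) ^ R.b 1 0) +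
      hs (R.b 1 0))
  · have e1 : z₁ - z₂ - -z₂ = z₁ := by ring
    have e2 : -z₂ - (z₁ - z₂) = -z₁ := by ring
    rw [e1, e2]
    have := neg_ne_zero.2 h1
    have := neg_ne_zero.2 h2
    positivity
  · positivity

theorem IsRational.add {F G : ℂ → ℂ → ℂ} (hF : IsRational F) (hG : IsRational G) :
    IsRational fun z₁ z₂ => F z₁ z₂ + G z₁ z₂ := by
  obtain ⟨p, a, b, c, h⟩ := hF
  obtain ⟨p', a', b', c', h'⟩ := hG
  refine ⟨p * (MvPolynomial.X 0 ^ a' * MvPolynomial.X 1 ^ b' *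
      (MvPolynomial.X 0 - MvPolynomial.X 1) ^ c') +
    p' * (MvPolynomial.X 0 ^ a * MvPolynomial.X 1 ^ b *
      (MvPolynomial.X 0 - MvPolynomial.X 1) ^ c), a + a', b + b', c + c',
    fun z₁ z₂ h1 h2 h3 => ?_⟩
  have h12 : z₁ - z₂ ≠ 0 := sub_ne_zero.2 h3
  simp only [h z₁ z₂ h1 h2 h3, h' z₁ z₂ h1 h2 h3, map_add, map_mul, map_pow, map_sub,
    MvPolynomial.eval_X, Matrix.cons_val_zero, Matrix.cons_val_one, pow_add]
  field_simp

theorem IsRational.pow_mul {F : ℂ → ℂ → ℂ} (hF : IsRational F) (l : ℕ) :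
    IsRational fun z₁ z₂ => z₂ ^ l * F z₁ z₂ := by
  obtain ⟨p, a, b, c, h⟩ := hF
  refine ⟨MvPolynomial.X 1 ^ l * p, a, b, c, fun z₁ z₂ h1 h2 h3 => ?_⟩
  simp [h z₁ z₂ h1 h2 h3, mul_div_assoc]

theorem isRational_sum (M : ℕ) {F : ℕ → ℂ → ℂ → ℂ} (hF : ∀ l, IsRational (F l)) :
    IsRational fun z₁ z₂ => ∑ l ∈ Finset.range M, F l z₁ z₂ := by
  induction M with
  | zero => exact ⟨0, 0, 0, 0, fun z₁ z₂ _ _ _ => by simp⟩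
  | succ M ih =>
    simp only [Finset.sum_range_succ]
    exact ih.add (hF M)

theorem hasSum_shift {r : ℤ × ℤ → ℂ} {z₁ z₂ s : ℂ} (hz1 : z₁ ≠ 0) (hz2 : z₂ ≠ 0)
    (h : HasSum (fun k : ℤ × ℤ => r k * z₁ ^ (-k.1 - 1) * z₂ ^ (-k.2 - 1)) s) (m n : ℤ) :
    HasSum (fun k : ℤ × ℤ => r (k.1 + m, k.2 + n) * z₁ ^ (-k.1 - 1) * z₂ ^ (-k.2 - 1))
      (z₁ ^ m * z₂ ^ n * s) := by
  have := (((Equiv.addRight m).prodCongr (Equiv.addRight n)).hasSum_iff.2 h).mul_left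
    (z₁ ^ m * z₂ ^ n)
  refine hasSum_congr_of_eq this (fun k => ?_) rfl
  have e1 : z₁ ^ (-k.1 - 1) = z₁ ^ m * z₁ ^ (-(k.1 + m) - 1) := by
    rw [← zpow_add₀ hz1]; congr 1; ring
  have e2 : z₂ ^ (-k.2 - 1) = z₂ ^ n * z₂ ^ (-(k.2 + n) - 1) := by
    rw [← zpow_add₀ hz2]; congr 1; ring
  simp only [Function.comp, Equiv.prodCongr_apply, Prod.map, Equiv.coe_addRight]
  rw [e1, e2]
  ring

/-- `F` is the sum of a Laurent series in the region `|z₁| > |z₂| > 0`. -/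
def HasLaurent (F : ℂ → ℂ → ℂ) : Prop :=
  ∃ r : ℤ × ℤ → ℂ, ∀ z₁ z₂ : ℂ, ‖z₂‖ < ‖z₁‖ → 0 < ‖z₂‖ →
    HasSum (fun k : ℤ × ℤ => r k * z₁ ^ (-k.1 - 1) * z₂ ^ (-k.2 - 1)) (F z₁ z₂)

theorem HasLaurent.add {F G : ℂ → ℂ → ℂ} (hF : HasLaurent F) (hG : HasLaurent G) :
    HasLaurent fun z₁ z₂ => F z₁ z₂ + G z₁ z₂ := by
  obtain ⟨r, hr⟩ := hF
  obtain ⟨s, hs⟩ := hG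
  exact ⟨fun k => r k + s k, fun z₁ z₂ h h0 =>
    hasSum_congr_of_eq ((hr z₁ z₂ h h0).add (hs z₁ z₂ h h0)) (fun k => by ring) rfl⟩

theorem HasLaurent.const_mul {F : ℂ → ℂ → ℂ} (hF : HasLaurent F) (a : ℂ) :
    HasLaurent fun z₁ z₂ => a * F z₁ z₂ := by
  obtain ⟨r, hr⟩ := hF
  exact ⟨fun k => a * r k, fun z₁ z₂ h h0 =>
    hasSum_congr_of_eq ((hr z₁ z₂ h h0).mul_left a) (fun k => by ring) rfl⟩

theorem HasLaurent.zpow_mul {F : ℂ → ℂ → ℂ} (hF : HasLaurent F) (m n : ℤ) :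
    HasLaurent fun z₁ z₂ => z₁ ^ m * z₂ ^ n * F z₁ z₂ := by
  obtain ⟨r, hr⟩ := hF
  exact ⟨fun k => r (k.1 + m, k.2 + n), fun z₁ z₂ h h0 =>
    hasSum_shift (norm_pos_iff.1 (h0.trans h)) (norm_pos_iff.1 h0) (hr z₁ z₂ h h0) m n⟩

theorem HasLaurent.eval_mul {F : ℂ → ℂ → ℂ} (hF : HasLaurent F)
    (p : MvPolynomial (Fin 2) ℂ) :
    HasLaurent fun z₁ z₂ => MvPolynomial.eval ![z₁, z₂] p * F z₁ z₂ := by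
  induction p using MvPolynomial.induction_on with
  | C a => simpa using hF.const_mul a
  | add p q hp hq => simpa only [map_add, add_mul] using hp.add hq
  | mul_X p i hp =>
    fin_cases i
    · convert hp.zpow_mul 1 0 using 3
      simp
      ring
    · convert hp.zpow_mul 0 1 using 3
      simp
      ring

theorem hasLaurent_zpow_sub (n : ℤ) : HasLaurent fun z₁ z₂ => (z₁ - z₂) ^ (-n - 1) := by
  let e : ℕ → ℤ × ℤ := fun i => (n + i, -i - 1)
  have he : Function.Injective e := fun i j h => by
    have := congrArg Prod.fst h
    simp only [e] at this
    omega
  refine ⟨Function.extend e (fun i => binom (n + i) i) 0, fun z₁ z₂ h h0 => ?_⟩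
  rw [← he.hasSum_iff]
  · refine hasSum_congr_of_eq (hasSum_binom_mul_zpow n z₁ z₂ h) (fun i => ?_) rfl
    simp only [Function.comp, he.extend_apply]
    simp only [e]
    have e1 : -(n + (i : ℤ)) - 1 = -n - 1 - i := by ring
    have e2 : -(-(i : ℤ) - 1) - 1 = i := by ring
    rw [e1, e2, zpow_natCast]
  · intro k hk
    rw [Function.extend_apply' _ _ _ (by simpa using hk)]
    simp

theorem IsRational.hasLaurent {F : ℂ → ℂ → ℂ} (hF : IsRational F) : HasLaurent F := by
  obtain ⟨p, a, b, c, h⟩ := hF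
  obtain ⟨r, hr⟩ := ((hasLaurent_zpow_sub (c - 1)).zpow_mul (-a) (-b)).eval_mul p
  refine ⟨r, fun z₁ z₂ h12 h0 => ?_⟩
  have hne : z₁ ≠ z₂ := fun h => by simp [h] at h12
  rw [h z₁ z₂ (norm_pos_iff.1 (h0.trans h12)) (norm_pos_iff.1 h0) hne]
  refine hasSum_congr_of_eq (hr z₁ z₂ h12 h0) (fun _ => rfl) ?_
  have e : -((c : ℤ) - 1) - 1 = -c := by ring
  simp only [e, zpow_neg, zpow_natCast]
  rw [div_eq_mul_inv, mul_inv, mul_inv]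

/-- A double series which converges to a rational function for `|z₁| > 2|z₂| > 0` does so
in the region `|z₁| > |z₂| > 0`. -/
theorem IsRational.hasSum_extend {F : ℂ → ℂ → ℂ} (hF : IsRational F) {f : ℤ × ℤ → ℂ}
    (hf : ∀ z₁ z₂ : ℂ, 2 * ‖z₂‖ < ‖z₁‖ → 0 < ‖z₂‖ →
      HasSum (fun k : ℤ × ℤ => f k * z₁ ^ (-k.1 - 1) * z₂ ^ (-k.2 - 1)) (F z₁ z₂))
    {z₁ z₂ : ℂ} (h : ‖z₂‖ < ‖z₁‖) (h0 : 0 < ‖z₂‖) :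
    HasSum (fun k : ℤ × ℤ => f k * z₁ ^ (-k.1 - 1) * z₂ ^ (-k.2 - 1)) (F z₁ z₂) := by
  obtain ⟨r, hr⟩ := hF.hasLaurent
  have : f = r := laurent_coeff_unique (F := F) (r₁ := 3) (r₂ := 1) (by norm_num) (by norm_num)
    (fun z₁ z₂ h1 h2 => hf z₁ z₂ (by rw [h1, h2]; norm_num) (by rw [h2]; norm_num))
    (fun z₁ z₂ h1 h2 => hr z₁ z₂ (by rw [h1, h2]; norm_num) (by rw [h2]; norm_num))
  exact this ▸ hr z₁ z₂ h h0

section Bimodule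

variable {V : Type*} [AddCommGroup V] [Module ℂ V] {W : Type*} [AddCommGroup W] [Module ℂ W]
  {A : MOSVA V}

/-! ### The translation operator of a bimodule -/

/-- The functional `w ↦ φ (D_W^l w) / l!`. -/
def Bimod.dualD (B : Bimod A W) (φ : W →ₗ[ℂ] ℂ) (l : ℕ) : W →ₗ[ℂ] ℂ :=
  ((l.factorial : ℂ))⁻¹ • (φ ∘ₗ (B.DW ^ l))

theorem Bimod.DW_pow_proj (B : Bimod A W) (l : ℕ) (n : ℂ) (w : W) :
    (B.DW ^ l) (B.gr.proj n w) = B.gr.proj (n + l) ((B.DW ^ l) (B.gr.proj n w)) := by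
  induction l with
  | zero =>
    have h := LinearMap.congr_fun (B.gr.proj_comp n n) w
    simpa using h.symm
  | succ l ih =>
    have h := LinearMap.congr_fun (B.DW_wt (n + l)) ((B.DW ^ l) (B.gr.proj n w))
    simp only [LinearMap.comp_apply] at h
    rw [← ih] at h
    rw [pow_succ', Module.End.mul_apply]
    push_cast
    rw [← add_assoc]
    exact h

theorem Bimod.comp_proj_ne_zero (B : Bimod A W) {φ : W →ₗ[ℂ] ℂ} {l : ℕ} {n : ℂ}
    (h : B.dualD φ l ∘ₗ B.gr.proj n ≠ 0) : φ ∘ₗ B.gr.proj (n + l) ≠ 0 := by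
  contrapose! h
  ext w
  simp only [dualD, LinearMap.comp_apply, LinearMap.smul_apply, LinearMap.zero_apply]
  rw [B.DW_pow_proj]
  have := LinearMap.congr_fun h ((B.DW ^ l) (B.gr.proj n w))
  simp only [LinearMap.comp_apply, LinearMap.zero_apply] at this
  rw [this, smul_zero]

theorem Bimod.inGradedDual_dualD (B : Bimod A W) {φ : W →ₗ[ℂ] ℂ}
    (hφ : InGradedDual B.gr.proj φ) (l : ℕ) : InGradedDual B.gr.proj (B.dualD φ l) :=
  (hφ.preimage ((add_left_injective (l : ℂ)).injOn)).subset fun _ h => B.comp_proj_ne_zero h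

theorem Bimod.exists_dualD_eq_zero (B : Bimod A W) {φ : W →ₗ[ℂ] ℂ}
    (hφ : InGradedDual B.gr.proj φ) : ∃ M : ℕ, ∀ l, M ≤ l → B.dualD φ l = 0 := by
  obtain ⟨b, hb⟩ := B.gr.lower_bound
  obtain ⟨S, hS⟩ := (hφ.image Complex.re).bddAbove
  obtain ⟨M, hM⟩ := exists_nat_gt (S - b)
  refine ⟨M, fun l hl => ?_⟩
  have hz : ∀ n, B.dualD φ l ∘ₗ B.gr.proj n = 0 := by
    intro n
    by_contra h
    have h1 := hS ⟨n + l, B.comp_proj_ne_zero h, rfl⟩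
    simp only [Complex.add_re, Complex.natCast_re] at h1
    have h2 : (M : ℝ) ≤ l := by exact_mod_cast hl
    rw [hb n (by linarith)] at h
    exact h (by simp)
  ext w
  rw [← B.gr.proj_sum w, map_finsum _ (B.gr.proj_finite w)]
  simp only [← LinearMap.comp_apply, hz]
  simp

theorem Bimod.YL_DW_pow (B : Bimod A W) (u : V) (w : W) (m : ℕ) (k : ℤ) :
    B.YL u ((B.DW ^ m) w) k = ∑ p ∈ Finset.HasAntidiagonal.antidiagonal m,
      ((m.factorial : ℂ) * ((p.1.factorial : ℂ))⁻¹ * binom k p.2) •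
        (B.DW ^ p.1) (B.YL u w (k - p.2)) := by
  let 𝒟 : Module.End ℂ (ℤ → W) := LinearMap.pi fun k => B.DW ∘ₗ LinearMap.proj k
  let S : Module.End ℂ (ℤ → W) := LinearMap.pi fun k => (k : ℂ) • LinearMap.proj (k - 1)
  have hcomm : Commute 𝒟 S := by
    refine LinearMap.ext fun x => funext fun k => ?_
    simp [𝒟, S]
  have hD : ∀ (i : ℕ) (x : ℤ → W) (k : ℤ), (𝒟 ^ i) x k = (B.DW ^ i) (x k) := by
    intro i
    induction i with
    | zero => simp
    | succ i ih =>
      intro x k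
      rw [pow_succ, pow_succ, Module.End.mul_apply, Module.End.mul_apply, ih]
      rfl
  have hS : ∀ (i : ℕ) (x : ℤ → W) (k : ℤ), (S ^ i) x k =
      ((i.factorial : ℂ) * binom k i) • x (k - i) := by
    intro i
    induction i with
    | zero => simp [binom]
    | succ i ih =>
      intro x k
      have hi : (i.factorial : ℂ) ≠ 0 := by exact_mod_cast i.factorial_ne_zero
      have hi' : ((i + 1).factorial : ℂ) ≠ 0 := by exact_mod_cast (i + 1).factorial_ne_zero
      rw [pow_succ, Module.End.mul_apply, ih]
      simp only [S, LinearMap.pi_apply, LinearMap.smul_apply, LinearMap.proj_apply, smul_smul]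
      rw [binom, binom, mul_div_cancel₀ _ hi, mul_div_cancel₀ _ hi', Finset.prod_range_succ]
      push_cast
      rw [← sub_sub]
  have hYL : ∀ (m : ℕ) (w : W), B.YL u ((B.DW ^ m) w) = ((𝒟 + S) ^ m) (B.YL u w) := by
    intro m
    induction m with
    | zero => simp
    | succ m ih =>
      intro w
      rw [pow_succ, pow_succ, Module.End.mul_apply, Module.End.mul_apply, ih]
      congr 1
      funext k
      have := B.D_commL u w k
      simp only [𝒟, S, LinearMap.add_apply, Pi.add_apply, LinearMap.pi_apply,
        LinearMap.comp_apply, LinearMap.smul_apply, LinearMap.proj_apply]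
      rw [neg_smul, sub_eq_iff_eq_add] at this
      rw [this]
      abel
  rw [hYL, hcomm.add_pow']
  simp only [LinearMap.sum_apply, Finset.sum_apply]
  refine Finset.sum_congr rfl fun p hp => ?_
  rw [LinearMap.smul_apply, Pi.smul_apply, Module.End.mul_apply, hD, hS, map_smul,
    ← Nat.cast_smul_eq_nsmul ℂ, smul_smul]
  congr 1
  rw [Finset.HasAntidiagonal.mem_antidiagonal] at hp
  rw [← hp, Nat.cast_add_choose]
  have h1 : (p.1.factorial : ℂ) ≠ 0 := by exact_mod_cast p.1.factorial_ne_zero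
  have h2 : (p.2.factorial : ℂ) ≠ 0 := by exact_mod_cast p.2.factorial_ne_zero
  field_simp

theorem Bimod.YsR_eq_sum (B : Bimod A W) (v : V) (w : W) {N : ℤ}
    (hN : ∀ k, N ≤ k → B.YR w v k = 0) (k : ℤ) {K : ℕ} (hK : N ≤ k + K) :
    B.YsR v w k = ∑ m ∈ Finset.range K, (((-1 : ℂ) ^ (k + (m : ℤ) + 1)) *
      ((m.factorial : ℂ))⁻¹) • ((B.DW ^ m) (B.YR w v (k + (m : ℤ)))) := by
  refine finsum_eq_sum_of_support_subset _ fun m hm => ?_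
  by_contra h
  simp only [Finset.coe_range, Set.mem_Iio, not_lt] at h
  exact hm (by simp only [hN (k + m) (by omega), map_zero, smul_zero])

theorem Bimod.apply_YsR (B : Bimod A W) {φ : W →ₗ[ℂ] ℂ} {M : ℕ}
    (hM : ∀ l, M ≤ l → B.dualD φ l = 0) (v : V) (w : W) (k : ℤ) :
    φ (B.YsR v w k) = ∑ l ∈ Finset.range M,
      (-1 : ℂ) ^ (k + l + 1) * B.dualD φ l (B.YR w v (k + l)) := by
  obtain ⟨N, hN⟩ := B.truncR w v
  have hK : N ≤ k + ((M + (N - k).toNat : ℕ) : ℤ) := by omega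
  rw [B.YsR_eq_sum v w hN k hK, map_sum]
  symm
  refine (Finset.sum_subset (Finset.range_mono (Nat.le_add_right M _)) fun l _ hl => ?_).trans
    (Finset.sum_congr rfl fun l _ => ?_)
  · rw [hM l (by simpa using hl)]
    simp
  · simp [dualD, mul_assoc]

theorem Bimod.apply_YL_YsR (B : Bimod A W) {φ : W →ₗ[ℂ] ℂ} {M : ℕ}
    (hM : ∀ l, M ≤ l → B.dualD φ l = 0) (u v : V) (w : W) (k₁ k₂ : ℤ) :
    φ (B.YL u (B.YsR v w k₂) k₁) = ∑ l ∈ Finset.range M, ∑' i : ℕ,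
      (-1 : ℂ) ^ (k₂ + l + i + 1) * binom k₁ i *
        B.dualD φ l (B.YL u (B.YR w v (k₂ + l + i)) (k₁ - i)) := by
  obtain ⟨N, hN⟩ := B.truncR w v
  set K := M + (N - k₂).toNat with hKdef
  have hK : N ≤ k₂ + (K : ℤ) := by omega
  set f : ℕ → ℕ → ℂ := fun l i => (-1 : ℂ) ^ (k₂ + l + i + 1) * binom k₁ i *
        B.dualD φ l (B.YL u (B.YR w v (k₂ + l + i)) (k₁ - i)) with hf
  have h1 : φ (B.YL u (B.YsR v w k₂) k₁) = ∑ m ∈ Finset.range K,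
      ∑ l ∈ Finset.range (m + 1), f l (m - l) := by
    rw [B.YsR_eq_sum v w hN k₂ hK, map_sum, Finset.sum_apply, map_sum]
    refine Finset.sum_congr rfl fun m _ => ?_
    rw [map_smul, Pi.smul_apply, map_smul, B.YL_DW_pow, map_sum,
      ← Finset.Nat.sum_antidiagonal_eq_sum_range_succ, Finset.smul_sum]
    refine Finset.sum_congr rfl fun p hp => ?_
    rw [Finset.HasAntidiagonal.mem_antidiagonal] at hp
    have hm : (m.factorial : ℂ) ≠ 0 := by exact_mod_cast m.factorial_ne_zero
    have e : k₂ + (p.1 : ℤ) + p.2 = k₂ + m := by rw [← hp]; push_cast; ring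
    simp only [hf, e, dualD, map_smul, LinearMap.smul_apply, LinearMap.comp_apply, smul_eq_mul]
    field_simp
  rw [h1, Finset.sum_range_diag_flip]
  symm
  refine (Finset.sum_subset (Finset.range_mono (Nat.le_add_right M _)) fun l _ hl => ?_).trans
    (Finset.sum_congr rfl fun l hl => ?_)
  · simp [hM l (by simpa using hl)]
  · refine tsum_eq_sum fun i hi => ?_
    rw [Finset.mem_range] at hl hi
    rw [hN (k₂ + l + i) (by omega)]
    simp

end Bimodule

/-- Let `V` be a meromorphic open-string vertex algebra and `W` a
`V`-bimodule. Then for all `u₁, u₂ ∈ V`, `w ∈ W` and `w' ∈ W'`, the series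
`⟨w', Y_W^L(u₁,z₁)Y_W^{s(R)}(u₂,z₂)w⟩` and `⟨w', Y_W^{s(R)}(u₂,z₂)Y_W^L(u₁,z₁)w⟩`
converge absolutely in the regions `|z₁| > |z₂| > 0` and `|z₂| > |z₁| > 0`
respectively, to a common rational function in `z₁` and `z₂`. -/
theorem statement1 {V : Type*} [AddCommGroup V] [Module ℂ V]
    {W : Type*} [AddCommGroup W] [Module ℂ W]
    (A : MOSVA V) (B : Bimod A W)
    (u₁ u₂ : V) (w : W) (φ : W →ₗ[ℂ] ℂ) (hφ : InGradedDual B.gr.proj φ) :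
    ∃ R : RatFn (Fin 2),
      (∀ z₁ z₂ : ℂ, ‖z₂‖ < ‖z₁‖ → 0 < ‖z₂‖ →
        AbsConvTo (fun k : ℤ × ℤ =>
            φ (B.YL u₁ (B.YsR u₂ w k.2) k.1) * z₁ ^ (-k.1 - 1) * z₂ ^ (-k.2 - 1))
          (R.eval ![z₁, z₂])) ∧
      (∀ z₁ z₂ : ℂ, ‖z₁‖ < ‖z₂‖ → 0 < ‖z₁‖ →
        AbsConvTo (fun k : ℤ × ℤ =>
            φ (B.YsR u₂ (B.YL u₁ w k.1) k.2) * z₁ ^ (-k.1 - 1) * z₂ ^ (-k.2 - 1))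
          (R.eval ![z₁, z₂])) := by
  obtain ⟨M, hM⟩ := B.exists_dualD_eq_zero hφ
  choose R hprod hiter using fun l : ℕ =>
    B.compatAssoc u₁ u₂ w (B.dualD φ l) (B.inGradedDual_dualD hφ l)
  have hrat : IsRational fun z₁ z₂ =>
      ∑ l ∈ Finset.range M, z₂ ^ l * (R l).eval ![z₁ - z₂, -z₂] :=
    isRational_sum M fun l => (isRational_eval_sub_neg (R l)).pow_mul l
  obtain ⟨S, hS⟩ := hrat.exists_ratFn
  simp only [absConvTo_iff_hasSum] at hprod hiter ⊢
  refine ⟨S, fun z₁ z₂ h h0 => ?_, fun z₁ z₂ h h0 => ?_⟩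
  · have hne : z₁ ≠ z₂ := fun e => by simp [e] at h
    rw [← hS z₁ z₂ (norm_pos_iff.1 (h0.trans h)) (norm_pos_iff.1 h0) hne]
    refine hrat.hasSum_extend (f := fun k => φ (B.YL u₁ (B.YsR u₂ w k.2) k.1))
      (fun x₁ x₂ h h0 => ?_) h h0
    obtain ⟨N, hN⟩ := B.truncR w u₂
    have hx1 : x₁ ≠ 0 := norm_pos_iff.1 (by linarith)
    have hx2 : x₂ ≠ 0 := norm_pos_iff.1 h0
    have hl : ∀ l : ℕ, _ := fun l => hasSum_shift hx1 hx2 (hasSum_subst_sub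
      (c := fun k => ∑' i : ℕ, (-1) ^ (k.2 + i + 1) * binom k.1 i *
        B.dualD φ l (B.YL u₁ (B.YR w u₂ (k.2 + i)) (k.1 - i))) (hprod l) (fun k => by
          refine (summable_of_ne_finset_zero (s := Finset.range (N - k.2).toNat)
            fun i hi => ?_).hasSum
          rw [Finset.mem_range] at hi
          rw [hN (k.2 + i) (by omega)]
          simp) h h0) 0 l
    refine hasSum_congr_of_eq (hasSum_sum fun l (_ : l ∈ Finset.range M) => hl l)
      (fun k => ?_) ?_
    · rw [B.apply_YL_YsR hM, ← Finset.sum_mul, ← Finset.sum_mul]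
      simp
    · simp
  · have hz1 : z₁ ≠ 0 := norm_pos_iff.1 h0
    have hz2 : z₂ ≠ 0 := norm_pos_iff.1 (h0.trans h)
    have hne : z₁ ≠ z₂ := fun e => by simp [e] at h
    rw [← hS z₁ z₂ hz1 hz2 hne]
    have hl : ∀ l : ℕ, HasSum (fun k : ℤ × ℤ =>
        (-1 : ℂ) ^ (k.2 + (l : ℤ) + 1) * B.dualD φ l (B.YR (B.YL u₁ w (k.1 + 0)) u₂ (k.2 + l)) *
          z₁ ^ (-k.1 - 1) * z₂ ^ (-k.2 - 1)) _ := fun l =>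
      hasSum_shift (r := fun k => (-1 : ℂ) ^ (k.2 + 1) *
          B.dualD φ l (B.YR (B.YL u₁ w k.1) u₂ k.2)) hz1 hz2
        (hasSum_congr_of_eq (hiter l (z₁ - z₂) (-z₂) (by simpa using h) (by simpa using hz1))
          (fun k => by
            rw [show z₁ - z₂ - -z₂ = z₁ by ring, neg_zpow_neg_sub_one]
            ring) rfl) 0 l
    refine hasSum_congr_of_eq (hasSum_sum fun l (_ : l ∈ Finset.range M) => hl l)
      (fun k => ?_) ?_
    · rw [B.apply_YsR hM, ← Finset.sum_mul, ← Finset.sum_mul]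
      simp
    · simp

end VA
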